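/- Let N = ∏_p p^{n_p} be a positive integer, and for each prime p dividing N let e_p be an integer with 0 ≤ e_p ≤ n_p. Let K^{(1)} be the subgroup of GL₂(A_ℚ) consisting of those g with g_∞ ∈ SO₂(ℝ) and g_p ∈ K^{(1)}(p^{n_p}) for every finite prime p (so g_p ∈ GL₂(ℤ_p) for p not dividing N). Then the set D_N·∏_{p | N} a(p^{e_p}) ⊂ GL₂(A_ℚ) contains representatives of every double coset of Z(A_ℚ)·GL₂(ℚ)\GL₂(A_ℚ)/K^{(1)}; that is, for every g ∈ GL₂(A_ℚ) there exist z ∈ Z(A_ℚ), γ ∈ GL₂(ℚ), d ∈ D_N and k ∈ K^{(1)} with g = z·γ·(d·∏_{p | N} a(p^{e_p}))·k, where a(p^{e_p}) is the adelic element equal to a(p^{e_p}) at the place p and to the identity at all other places. -/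

import Mathlib

noncomputable section

open Matrix

instance (p : Nat.Primes) : Fact (p : ℕ).Prime := ⟨p.2⟩

/-- The completion `ℚ_p` of `ℚ` at a prime `p`. -/
abbrev Qp (p : Nat.Primes) : Type := ℚ_[(p : ℕ)]

/-- Membership in `GL₂(ℤ_p)`: all entries are `p`-adic integers and the determinant is a
`p`-adic unit. -/
def InGL2Zp (p : Nat.Primes) (k : Matrix (Fin 2) (Fin 2) (Qp p)) : Prop :=
  (∀ i j, ‖k i j‖ ≤ 1) ∧ ‖k.det‖ = 1

/-- Membership in `K^{(1)}(p^n) ⊆ GL₂(ℤ_p)`: `a - 1 ∈ p^n ℤ_p` and `c ∈ p^n ℤ_p`. -/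
def K1 (p : Nat.Primes) (n : ℕ) (k : Matrix (Fin 2) (Fin 2) (Qp p)) : Prop :=
  InGL2Zp p k ∧ ‖k 0 0 - 1‖ ≤ ((p : ℕ) : ℝ) ^ (-(n : ℤ)) ∧
    ‖k 1 0‖ ≤ ((p : ℕ) : ℝ) ^ (-(n : ℤ))

/-- `a(y) = [[y,0],[0,1]]` over `ℚ_p`. -/
def amat (p : Nat.Primes) (y : Qp p) : Matrix (Fin 2) (Fin 2) (Qp p) :=
  !![y, 0; 0, 1]

/-- An element of `GL₂(𝔸_ℚ)`, recorded through its components: an invertible real `2 × 2`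
matrix at the infinite place, an invertible `2 × 2` matrix over `ℚ_p` at each finite prime
`p`, lying in `GL₂(ℤ_p)` for all but finitely many `p`. -/
structure AdelicGL2 where
  infty : Matrix (Fin 2) (Fin 2) ℝ
  fin : ∀ p : Nat.Primes, Matrix (Fin 2) (Fin 2) (Qp p)
  isUnit_infty : IsUnit infty.det
  isUnit_fin : ∀ p, IsUnit (fin p).det
  finite_not_integral : {p : Nat.Primes | ¬ InGL2Zp p (fin p)}.Finite

/-- Membership in the center `Z(𝔸_ℚ)` of `GL₂(𝔸_ℚ)`: every component is a scalar matrix. -/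
def AdelicGL2.IsCentral (z : AdelicGL2) : Prop :=
  (∃ y : ℝ, z.infty = y • (1 : Matrix (Fin 2) (Fin 2) ℝ)) ∧
    ∀ p : Nat.Primes, ∃ y : Qp p, z.fin p = y • (1 : Matrix (Fin 2) (Fin 2) (Qp p))

/-- Membership in `SO₂(ℝ)`. -/
def SO2 (k : Matrix (Fin 2) (Fin 2) ℝ) : Prop :=
  k * kᵀ = 1 ∧ k.det = 1

/-- Membership in the generating domain `𝒟_N`: the infinite component is `n(x) a(y)` with
`y ≥ √3/2`, the component at each prime `p ∤ N` is the identity, and the component at each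
prime lies in `GL₂(ℤ_p)`. -/
def InDN (N : ℕ) (d : AdelicGL2) : Prop :=
  (∃ x y : ℝ, Real.sqrt 3 / 2 ≤ y ∧ d.infty = !![1, x; 0, 1] * !![y, 0; 0, 1]) ∧
    (∀ p : Nat.Primes, ¬ (p : ℕ) ∣ N → d.fin p = 1) ∧
    ∀ p : Nat.Primes, InGL2Zp p (d.fin p)

namespace InGL2Zp

variable {p : Nat.Primes} {A B : Matrix (Fin 2) (Fin 2) (Qp p)}

theorem mul (hA : InGL2Zp p A) (hB : InGL2Zp p B) : InGL2Zp p (A * B) := by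
  refine ⟨fun i j => ?_, by rw [det_mul, norm_mul, hA.2, hB.2, one_mul]⟩
  rw [mul_apply, Fin.sum_univ_two]
  refine (Padic.nonarchimedean _ _).trans (max_le ?_ ?_) <;> rw [norm_mul] <;>
    exact mul_le_one₀ (hA.1 _ _) (norm_nonneg _) (hB.1 _ _)

theorem one : InGL2Zp p 1 := by
  refine ⟨fun i j => ?_, by simp⟩
  rw [one_apply]
  split_ifs <;> simp

theorem intCast_map (σ : Matrix (Fin 2) (Fin 2) ℤ) (hσ : IsUnit σ.det) :
    InGL2Zp p ((σ.map (Int.cast : ℤ → ℚ)).map (Rat.cast : ℚ → Qp p)) := by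
  refine ⟨fun i j => by simpa using Padic.norm_int_le_one (p := p) (σ i j), ?_⟩
  have h : ((σ.map (Int.cast : ℤ → ℚ)).map (Rat.cast : ℚ → Qp p)).det = (σ.det : Qp p) := by
    simp [det_fin_two]
  rw [h]
  rcases Int.isUnit_iff.1 hσ with h | h <;> simp [h]

theorem k1 (hA : InGL2Zp p A) : K1 p 0 A := by
  refine ⟨hA, ?_, by simpa using hA.1 1 0⟩
  rw [sub_eq_add_neg]
  refine (Padic.nonarchimedean _ _).trans (max_le (hA.1 0 0) ?_)
  simp

end InGL2Zp

theorem K1.one (p : Nat.Primes) (n : ℕ) : K1 p n 1 :=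
  ⟨.one, by simp, by simp⟩

theorem Nat.Primes.norm_cast_eq_one {p q : Nat.Primes} (h : q ≠ p) :
    ‖((p : ℕ) : Qp q)‖ = 1 :=
  Padic.norm_natCast_eq_one_iff.2
    ((Nat.coprime_primes q.2 p.2).2 fun h' => h (Subtype.ext h'))

theorem Nat.Primes.cast_ne_zero {R : Type*} [Semiring R] [CharZero R] (p : Nat.Primes) :
    ((p : ℕ) : R) ≠ 0 :=
  Nat.cast_ne_zero.2 p.2.ne_zero

theorem exists_zpow_norm_eq (p : Nat.Primes) {x : Qp p} (hx : x ≠ 0) :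
    ∃ n : ℤ, ‖((p : ℕ) : Qp p) ^ n‖ = ‖x‖ :=
  ⟨x.valuation, by rw [Padic.norm_p_zpow, Padic.norm_eq_zpow_neg_valuation hx]⟩

theorem exists_natCast_norm_sub_lt (p : ℕ) [Fact p.Prime] {x : ℚ_[p]} (hx : ‖x‖ ≤ 1) {ε : ℝ}
    (hε : 0 < ε) : ∃ k : ℕ, ‖x - k‖ < ε := by
  obtain ⟨y, rfl⟩ : ∃ y : ℤ_[p], (y : ℚ_[p]) = x := ⟨⟨x, hx⟩, rfl⟩
  obtain ⟨k, hk⟩ := PadicInt.denseRange_natCast.exists_dist_lt y hε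
  rw [dist_eq_norm, PadicInt.norm_def] at hk
  exact ⟨k, by simpa using hk⟩

/-- Elements of `ℚ_p` are approximated by rationals that are integral away from `p`. -/
theorem exists_rat_approx (p : Nat.Primes) (x : Qp p) {ε : ℝ} (hε : 0 < ε) :
    ∃ t : ℚ, ‖x - t‖ ≤ ε ∧ ∀ q : Nat.Primes, q ≠ p → ‖(t : Qp q)‖ ≤ 1 := by
  obtain ⟨m, hm⟩ : ∃ m : ℤ, ‖x * ((p : ℕ) : Qp p) ^ m‖ ≤ 1 := by
    by_cases hx : x = 0
    · exact ⟨0, by simp [hx]⟩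
    obtain ⟨n, hn⟩ := exists_zpow_norm_eq p hx
    refine ⟨-n, ?_⟩
    rw [norm_mul, ← hn, ← norm_mul, ← zpow_add₀ p.cast_ne_zero]
    simp
  set P := ((p : ℕ) : Qp p) ^ m with hP
  have hP0 : P ≠ 0 := zpow_ne_zero _ p.cast_ne_zero
  obtain ⟨k, hk⟩ := exists_natCast_norm_sub_lt (p : ℕ) hm (mul_pos hε (norm_pos_iff.2 hP0))
  refine ⟨k * ((p : ℕ) : ℚ) ^ (-m), ?_, fun q hq => ?_⟩
  · have : x - ((k * ((p : ℕ) : ℚ) ^ (-m) : ℚ) : Qp p) = (x * P - k) / P := by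
      push_cast
      rw [_root_.zpow_neg, ← hP]
      field_simp
    rw [this, norm_div, div_le_iff₀ (norm_pos_iff.2 hP0)]
    exact hk.le
  · push_cast
    rw [norm_mul, norm_zpow, Nat.Primes.norm_cast_eq_one hq, _root_.one_zpow, mul_one]
    exact_mod_cast Padic.norm_int_le_one (p := q) k

theorem exists_rat_mul_inGL2Zp_of_norm_le (p : Nat.Primes) (M : Matrix (Fin 2) (Fin 2) (Qp p))
    (hM : M.det ≠ 0) (h : ‖M 1 0‖ ≤ ‖M 1 1‖) :
    ∃ δ : Matrix (Fin 2) (Fin 2) ℚ, δ.det ≠ 0 ∧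
      InGL2Zp p (δ.map (Rat.cast : ℚ → Qp p) * M) ∧
      ∀ q : Nat.Primes, q ≠ p → InGL2Zp q (δ.map (Rat.cast : ℚ → Qp q)) := by
  have hd : M 1 1 ≠ 0 := by
    intro h0
    have h1 : M 1 0 = 0 := by simpa [h0] using h
    exact hM (by simp [det_fin_two, h0, h1])
  obtain ⟨k, hk⟩ := exists_zpow_norm_eq p hd
  obtain ⟨a, ha⟩ := exists_zpow_norm_eq p (div_ne_zero hM hd)
  have hdpos := norm_pos_iff.2 hd
  have hapos : 0 < ‖((p : ℕ) : Qp p) ^ a‖ := norm_pos_iff.2 (zpow_ne_zero _ p.cast_ne_zero)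
  obtain ⟨t, ht, ht'⟩ := exists_rat_approx p (M 0 1 / M 1 1) (div_pos hapos hdpos)
  have hb : ‖M 0 1 - t * M 1 1‖ ≤ ‖((p : ℕ) : Qp p) ^ a‖ := by
    have : M 0 1 - t * M 1 1 = (M 0 1 / M 1 1 - t) * M 1 1 := by field_simp
    rw [this, norm_mul]
    exact (le_div_iff₀ hdpos).1 ht
  have hc : ‖M 0 0 - t * M 1 0‖ ≤ ‖((p : ℕ) : Qp p) ^ a‖ := by
    have : M 0 0 - t * M 1 0 =
        M.det / M 1 1 + M 1 0 / M 1 1 * (M 0 1 - t * M 1 1) := by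
      rw [det_fin_two]; field_simp; ring
    rw [this]
    refine (Padic.nonarchimedean _ _).trans (max_le ha.ge ?_)
    rw [norm_mul, norm_div]
    exact (mul_le_of_le_one_left (norm_nonneg _) ((div_le_one hdpos).2 h)).trans hb
  have hp : ((p : ℕ) : ℚ) ≠ 0 := p.cast_ne_zero
  set δ : Matrix (Fin 2) (Fin 2) ℚ :=
    !![(((p : ℕ) : ℚ) ^ a)⁻¹, -(t * (((p : ℕ) : ℚ) ^ a)⁻¹); 0, (((p : ℕ) : ℚ) ^ k)⁻¹] with hδ
  have hmap : ∀ q : Nat.Primes, δ.map (Rat.cast : ℚ → Qp q) =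
      !![(((p : ℕ) : Qp q) ^ a)⁻¹, -(t * (((p : ℕ) : Qp q) ^ a)⁻¹);
        0, (((p : ℕ) : Qp q) ^ k)⁻¹] := fun q => by
    ext i j
    fin_cases i <;> fin_cases j <;> simp [hδ]
  refine ⟨δ, by simp [hδ, det_fin_two, hp, zpow_ne_zero], ⟨?_, ?_⟩, fun q hq => ?_⟩
  · have key : ∀ u v : Qp p, ‖u - t * v‖ ≤ ‖((p : ℕ) : Qp p) ^ a‖ →
        ‖(((p : ℕ) : Qp p) ^ a)⁻¹ * u + -(t * (((p : ℕ) : Qp p) ^ a)⁻¹) * v‖ ≤ 1 := by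
      intro u v huv
      have : (((p : ℕ) : Qp p) ^ a)⁻¹ * u + -(t * (((p : ℕ) : Qp p) ^ a)⁻¹) * v =
          (u - t * v) / ((p : ℕ) : Qp p) ^ a := by ring
      rw [this, norm_div]
      exact (div_le_one hapos).2 huv
    have key' : ∀ u v : Qp p, ‖v‖ ≤ ‖M 1 1‖ →
        ‖0 * u + (((p : ℕ) : Qp p) ^ k)⁻¹ * v‖ ≤ 1 := by
      intro u v hv
      rw [zero_mul, zero_add, norm_mul, norm_inv, hk, inv_mul_le_one₀ hdpos]
      exact hv
    rw [hmap, eta_fin_two M, mul_fin_two]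
    intro i j
    fin_cases i <;> fin_cases j
    exacts [key _ _ hc, key _ _ hb, key' _ _ h, key' _ _ le_rfl]
  · have := norm_pos_iff.2 hM
    rw [hmap, det_mul, det_fin_two_of, mul_zero, sub_zero, norm_mul, norm_mul, norm_inv,
      norm_inv, ha, hk, norm_div]
    field_simp
  · have hq' : ∀ n : ℤ, ‖(((p : ℕ) : Qp q) ^ n)⁻¹‖ = 1 := fun n => by
      rw [norm_inv, norm_zpow, Nat.Primes.norm_cast_eq_one hq, _root_.one_zpow, inv_one]
    rw [hmap]
    refine ⟨fun i j => ?_, by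
      rw [det_fin_two_of, mul_zero, sub_zero, norm_mul, hq', hq', one_mul]⟩
    fin_cases i <;> fin_cases j
    · exact (hq' a).le
    · change ‖-(t * (((p : ℕ) : Qp q) ^ a)⁻¹)‖ ≤ 1
      rw [norm_neg, norm_mul, hq', mul_one]
      exact ht' q hq
    · change ‖(0 : Qp q)‖ ≤ 1
      simp
    · exact (hq' k).le

theorem exists_rat_mul_inGL2Zp (p : Nat.Primes) (M : Matrix (Fin 2) (Fin 2) (Qp p))
    (hM : M.det ≠ 0) :
    ∃ δ : Matrix (Fin 2) (Fin 2) ℚ, δ.det ≠ 0 ∧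
      InGL2Zp p (δ.map (Rat.cast : ℚ → Qp p) * M) ∧
      ∀ q : Nat.Primes, q ≠ p → InGL2Zp q (δ.map (Rat.cast : ℚ → Qp q)) := by
  rcases le_total ‖M 1 0‖ ‖M 1 1‖ with h | h
  · exact exists_rat_mul_inGL2Zp_of_norm_le p M hM h
  set w : Matrix (Fin 2) (Fin 2) (Qp p) := !![0, 1; 1, 0] with hw
  have hww : w * w = 1 := by simp [hw, one_fin_two]
  have hwdet : w.det = -1 := by simp [hw, det_fin_two]
  have hwin : InGL2Zp p w := by
    refine ⟨fun i j => ?_, by simp [hwdet]⟩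
    fin_cases i <;> fin_cases j <;> simp [hw]
  obtain ⟨δ, h0, h1, h2⟩ := exists_rat_mul_inGL2Zp_of_norm_le p (M * w)
    (by simpa [det_mul, hwdet] using hM) (by simpa [hw, mul_apply, Fin.sum_univ_two] using h)
  refine ⟨δ, h0, ?_, h2⟩
  have := h1.mul hwin
  rwa [Matrix.mul_assoc, Matrix.mul_assoc, hww, Matrix.mul_one] at this

theorem map_ratCast_mul {R : Type*} [DivisionRing R] [CharZero R]
    (A B : Matrix (Fin 2) (Fin 2) ℚ) :
    (A * B).map (Rat.cast : ℚ → R) = A.map Rat.cast * B.map Rat.cast :=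
  Matrix.map_mul (f := Rat.castHom R)

/-- `GL₂` over the finite adeles of `ℚ` is `GL₂(ℚ) · GL₂(ℤ̂)`. -/
theorem exists_rat_forall_inGL2Zp (S : Finset Nat.Primes) :
    ∀ M : ∀ p : Nat.Primes, Matrix (Fin 2) (Fin 2) (Qp p), (∀ p, (M p).det ≠ 0) →
      (∀ p ∉ S, InGL2Zp p (M p)) →
      ∃ δ : Matrix (Fin 2) (Fin 2) ℚ, δ.det ≠ 0 ∧
        ∀ p, InGL2Zp p (δ.map (Rat.cast : ℚ → Qp p) * M p) := by
  induction S using Finset.induction_on with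
  | empty =>
    intro M _ h
    refine ⟨1, by simp, fun p => ?_⟩
    rw [Matrix.map_one _ Rat.cast_zero Rat.cast_one, Matrix.one_mul]
    exact h p (by simp)
  | insert p S _ ih =>
    intro M hM h
    obtain ⟨δ, h0, h1, h2⟩ := exists_rat_mul_inGL2Zp p (M p) (hM p)
    have hdet : ∀ q : Nat.Primes, (δ.map (Rat.cast : ℚ → Qp q)).det ≠ 0 := fun q => by
      have : (δ.map (Rat.cast : ℚ → Qp q)).det = (δ.det : Qp q) := by simp [det_fin_two]
      rw [this]
      exact_mod_cast h0
    obtain ⟨δ', h0', h1'⟩ := ih (fun q => δ.map (Rat.cast : ℚ → Qp q) * M q)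
      (fun q => by rw [det_mul]; exact mul_ne_zero (hdet q) (hM q)) (fun q hq => by
        by_cases hqp : q = p
        · subst hqp; exact h1
        · exact (h2 q hqp).mul (h q (by simp [hqp, hq])))
    refine ⟨δ' * δ, by rw [det_mul]; exact mul_ne_zero h0' h0, fun q => ?_⟩
    rw [map_ratCast_mul, Matrix.mul_assoc]
    exact h1' q

/-- Iwasawa decomposition in `GL₂⁺(ℝ)`. -/
theorem exists_iwasawa (A : Matrix (Fin 2) (Fin 2) ℝ) (hA : 0 < A.det) :
    ∃ (r x : ℝ) (k : Matrix (Fin 2) (Fin 2) ℝ), r ≠ 0 ∧ SO2 k ∧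
      0 < A 1 0 ^ 2 + A 1 1 ^ 2 ∧
      A = r • (!![1, x; 0, 1] * !![A.det / (A 1 0 ^ 2 + A 1 1 ^ 2), 0; 0, 1] * k) := by
  have hpos : 0 < A 1 0 ^ 2 + A 1 1 ^ 2 := by
    by_contra! h
    have h0 : A 1 0 = 0 := by nlinarith [sq_nonneg (A 1 0), sq_nonneg (A 1 1)]
    have h1 : A 1 1 = 0 := by nlinarith [sq_nonneg (A 1 0), sq_nonneg (A 1 1)]
    simp [det_fin_two, h0, h1] at hA
  obtain ⟨ρ, hρ, hρ2⟩ : ∃ ρ : ℝ, ρ ≠ 0 ∧ ρ ^ 2 = A 1 0 ^ 2 + A 1 1 ^ 2 :=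
    ⟨_, (Real.sqrt_pos.2 hpos).ne', Real.sq_sqrt hpos.le⟩
  rw [← hρ2]
  refine ⟨ρ, (A 0 0 * A 1 0 + A 0 1 * A 1 1) / ρ ^ 2,
    !![A 1 1 / ρ, -(A 1 0 / ρ); A 1 0 / ρ, A 1 1 / ρ], hρ, ⟨?_, ?_⟩, by positivity, ?_⟩
  · ext i j
    fin_cases i <;> fin_cases j <;> simp [mul_apply, Fin.sum_univ_two] <;> field_simp <;>
      linarith
  · simp [det_fin_two]
    field_simp
    linarith
  · rw [det_fin_two]
    ext i j
    fin_cases i <;> fin_cases j <;> simp <;> field_simp <;> rw [hρ2] <;> ring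

theorem SO2.mul {A B : Matrix (Fin 2) (Fin 2) ℝ} (hA : SO2 A) (hB : SO2 B) : SO2 (A * B) := by
  refine ⟨?_, by rw [det_mul, hA.2, hB.2, one_mul]⟩
  rw [transpose_mul, Matrix.mul_assoc, ← Matrix.mul_assoc B, hB.1, Matrix.one_mul, hA.1]

/-- Reduction to the standard fundamental domain of `SL₂(ℤ)`, for matrices. -/
theorem exists_int_mul_eq_of_det_pos (A : Matrix (Fin 2) (Fin 2) ℝ) (hA : 0 < A.det) :
    ∃ (σ : Matrix (Fin 2) (Fin 2) ℤ) (r x y : ℝ) (k : Matrix (Fin 2) (Fin 2) ℝ),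
      IsUnit σ.det ∧ r ≠ 0 ∧ Real.sqrt 3 / 2 ≤ y ∧ SO2 k ∧
      σ.map (Int.cast : ℤ → ℝ) * A = r • (!![1, x; 0, 1] * !![y, 0; 0, 1] * k) := by
  obtain ⟨r, x, k, hr, hk, hpos, hAeq⟩ := exists_iwasawa A hA
  set y := A.det / (A 1 0 ^ 2 + A 1 1 ^ 2)
  have hy : 0 < y := div_pos hA hpos
  let τ : UpperHalfPlane := ⟨⟨x, y⟩, hy⟩
  obtain ⟨s, hs⟩ := ModularGroup.exists_smul_mem_fd τ
  set σ : Matrix (Fin 2) (Fin 2) ℤ := s.1 with hσs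
  set B := σ.map (Int.cast : ℤ → ℝ) * (!![1, x; 0, 1] * !![y, 0; 0, 1]) with hB
  have hσ : σ 0 0 * σ 1 1 - σ 0 1 * σ 1 0 = 1 := by
    rw [← det_fin_two]; exact s.2
  have hσ' : (σ 0 0 * σ 1 1 - σ 0 1 * σ 1 0 : ℝ) = 1 := by exact_mod_cast hσ
  have hBdet : B.det = y := by
    rw [hB, det_mul, det_mul, det_fin_two (σ.map _)]
    simp [hσ', det_fin_two]
  obtain ⟨r', x', k', hr', hk', -, hBeq⟩ := exists_iwasawa B (hBdet ▸ hy)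
  have him : (s • τ).im = B.det / (B 1 0 ^ 2 + B 1 1 ^ 2) := by
    rw [ModularGroup.im_smul_eq_div_normSq, hBdet, UpperHalfPlane.denom]
    simp [hB, mul_apply, Fin.sum_univ_two, Complex.normSq_apply, τ, UpperHalfPlane.im]
    rw [← hσs]
    ring
  refine ⟨σ, r * r', x', (s • τ).im, k' * k, by rw [det_fin_two, hσ]; exact isUnit_one,
    mul_ne_zero hr hr', ?_, hk'.mul hk, ?_⟩
  · have h3 := ModularGroup.three_le_four_mul_im_sq_of_mem_fd hs
    have := (s • τ).im_pos
    nlinarith [Real.sq_sqrt (show (0 : ℝ) ≤ 3 by norm_num), Real.sqrt_nonneg 3]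
  · rw [him, hAeq, Matrix.mul_smul, ← Matrix.mul_assoc, ← hB, mul_smul]
    conv_lhs => rw [hBeq]
    rw [Matrix.smul_mul, Matrix.mul_assoc]

theorem exists_int_mul_eq (A : Matrix (Fin 2) (Fin 2) ℝ) (hA : A.det ≠ 0) :
    ∃ (σ : Matrix (Fin 2) (Fin 2) ℤ) (r x y : ℝ) (k : Matrix (Fin 2) (Fin 2) ℝ),
      IsUnit σ.det ∧ r ≠ 0 ∧ Real.sqrt 3 / 2 ≤ y ∧ SO2 k ∧
      σ.map (Int.cast : ℤ → ℝ) * A = r • (!![1, x; 0, 1] * !![y, 0; 0, 1] * k) := by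
  rcases hA.lt_or_gt with h | h
  · set w : Matrix (Fin 2) (Fin 2) ℤ := !![-1, 0; 0, 1] with hw
    have hwdet : (w.map (Int.cast : ℤ → ℝ)).det = -1 := by simp [hw, det_fin_two]
    obtain ⟨σ, r, x, y, k, h1, h2, h3, h4, h5⟩ := exists_int_mul_eq_of_det_pos
      (w.map (Int.cast : ℤ → ℝ) * A) (by rw [det_mul, hwdet]; linarith)
    refine ⟨σ * w, r, x, y, k, ?_, h2, h3, h4, ?_⟩
    · rw [det_mul]
      exact h1.mul (by simp [hw, det_fin_two])
    · rw [← h5, ← Matrix.mul_assoc]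
      congr 1
      exact Matrix.map_mul (f := Int.castRingHom ℝ)
  · exact exists_int_mul_eq_of_det_pos A h

theorem det_amat (p : Nat.Primes) (y : Qp p) : (amat p y).det = y := by
  simp [amat, det_fin_two]

/-- Let `N = ∏_p p^{n_p} ≥ 1` and for each `p ∣ N` let `0 ≤ e_p ≤ n_p`.
Let `K^{(1)}` be the subgroup of `GL₂(𝔸_ℚ)` whose elements have infinite component in
`SO₂(ℝ)` and component at each finite prime `p` in `K^{(1)}(p^{n_p})`. Then the set
`𝒟_N ∏_{p ∣ N} a(p^{e_p})` contains representatives of every double coset of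
`Z(𝔸_ℚ) GL₂(ℚ) \ GL₂(𝔸_ℚ) / K^{(1)}`: every `g ∈ GL₂(𝔸_ℚ)` can be written as
`g = z γ (d ∏_{p ∣ N} a(p^{e_p})) k` with `z ∈ Z(𝔸_ℚ)`, `γ ∈ GL₂(ℚ)`, `d ∈ 𝒟_N` and
`k ∈ K^{(1)}`, where `∏_{p ∣ N} a(p^{e_p})` is the adelic element equal to `a(p^{e_p})`
at each place `p ∣ N` and to the identity at all other places. -/
theorem generating_domain_balanced (N : ℕ) (hN : 0 < N)
    (e : Nat.Primes → ℕ)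
    (he : ∀ p : Nat.Primes, (p : ℕ) ∣ N → e p ≤ padicValNat (p : ℕ) N)
    (g : AdelicGL2) :
    ∃ (z : AdelicGL2) (γ : Matrix (Fin 2) (Fin 2) ℚ) (d : AdelicGL2)
      (kinf : Matrix (Fin 2) (Fin 2) ℝ)
      (kfin : ∀ p : Nat.Primes, Matrix (Fin 2) (Fin 2) (Qp p)),
      z.IsCentral ∧ IsUnit γ.det ∧ InDN N d ∧ SO2 kinf ∧
      (∀ p : Nat.Primes, K1 p (padicValNat (p : ℕ) N) (kfin p)) ∧
      g.infty = z.infty * γ.map (Rat.cast : ℚ → ℝ) * d.infty * kinf ∧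
      ∀ p : Nat.Primes,
        g.fin p = z.fin p * γ.map (Rat.cast : ℚ → Qp p) *
          (d.fin p *
            (if (p : ℕ) ∣ N then amat p (((p : ℕ) : Qp p) ^ (e p)) else 1)) *
          kfin p := by
  let a : ∀ p : Nat.Primes, Matrix (Fin 2) (Fin 2) (Qp p) := fun p =>
    if (p : ℕ) ∣ N then amat p (((p : ℕ) : Qp p) ^ (e p)) else 1
  have ha : ∀ p, IsUnit (a p).det := fun p => by
    simp only [a]
    split_ifs
    · rw [det_amat]
      exact (pow_ne_zero _ p.cast_ne_zero).isUnit
    · simp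
  have hfin : {p : Nat.Primes | (p : ℕ) ∣ N}.Finite :=
    ((Set.finite_Iic N).preimage Subtype.val_injective.injOn).subset
      fun p hp => Nat.le_of_dvd hN hp
  obtain ⟨δ₀, hδ₀, hδ₀M⟩ := exists_rat_forall_inGL2Zp
    (g.finite_not_integral.toFinset ∪ hfin.toFinset) (fun p => g.fin p * (a p)⁻¹)
    (fun p => by
      rw [det_mul]
      exact mul_ne_zero (g.isUnit_fin p).ne_zero (isUnit_nonsing_inv_det _ (ha p)).ne_zero)
    (fun p hp => by
      simp only [Finset.mem_union, Set.Finite.mem_toFinset, Set.mem_ofPred_eq, not_or,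
        not_not] at hp
      simpa [a, hp.2] using hp.1)
  have hδ₀R : (δ₀.map (Rat.cast : ℚ → ℝ)).det = (δ₀.det : ℝ) := by simp [det_fin_two]
  obtain ⟨σ, r, x, y, k, hσ, hr, hy, hk, hσA⟩ := exists_int_mul_eq
    (δ₀.map (Rat.cast : ℚ → ℝ) * g.infty) (by
      rw [det_mul, hδ₀R]
      exact mul_ne_zero (by exact_mod_cast hδ₀) g.isUnit_infty.ne_zero)
  set δ : Matrix (Fin 2) (Fin 2) ℚ := σ.map (Int.cast : ℤ → ℚ) * δ₀ with hδ
  have hδdet : IsUnit δ.det := by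
    have : (σ.map (Int.cast : ℤ → ℚ)).det = (σ.det : ℚ) := by simp [det_fin_two]
    rw [hδ, det_mul, this]
    exact (mul_ne_zero (by exact_mod_cast hσ.ne_zero) hδ₀).isUnit
  have hinv : ∀ {R : Type} [DivisionRing R] [CharZero R],
      δ⁻¹.map (Rat.cast : ℚ → R) * δ.map (Rat.cast : ℚ → R) = 1 := by
    intro R _ _
    rw [← map_ratCast_mul, nonsing_inv_mul _ hδdet,
      Matrix.map_one _ Rat.cast_zero Rat.cast_one]
  have hM : ∀ p, InGL2Zp p (δ.map (Rat.cast : ℚ → Qp p) * (g.fin p * (a p)⁻¹)) := fun p => by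
    rw [hδ, map_ratCast_mul, Matrix.mul_assoc]
    exact (InGL2Zp.intCast_map σ hσ).mul (hδ₀M p)
  have hinf : δ.map (Rat.cast : ℚ → ℝ) * g.infty =
      r • (!![1, x; 0, 1] * !![y, 0; 0, 1] * k) := by
    rw [hδ, map_ratCast_mul, Matrix.mul_assoc, ← hσA]
    congr 1
  have hd : ∀ p : Nat.Primes, InGL2Zp p
      (if (p : ℕ) ∣ N then δ.map (Rat.cast : ℚ → Qp p) * (g.fin p * (a p)⁻¹) else 1) := by
    intro p
    split_ifs
    exacts [hM p, .one]
  have hy0 : y ≠ 0 := by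
    have : 0 < Real.sqrt 3 := Real.sqrt_pos.2 (by norm_num)
    exact (by linarith : 0 < y).ne'
  refine ⟨⟨r • 1, fun _ => 1, by simp [hr], fun _ => by simp, by simp [InGL2Zp.one]⟩,
    δ⁻¹, ⟨!![1, x; 0, 1] * !![y, 0; 0, 1], fun p => if (p : ℕ) ∣ N then
      δ.map (Rat.cast : ℚ → Qp p) * (g.fin p * (a p)⁻¹) else 1, by simp [det_fin_two, hy0],
      fun p => (norm_pos_iff.1 ((hd p).2 ▸ one_pos)).isUnit, by simp [hd]⟩, k,
    fun p => if (p : ℕ) ∣ N then 1 else δ.map (Rat.cast : ℚ → Qp p) * g.fin p,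
    ⟨⟨r, rfl⟩, fun p => ⟨1, by simp⟩⟩, isUnit_nonsing_inv_det _ hδdet,
    ⟨⟨x, y, hy, rfl⟩, fun p hp => if_neg hp, hd⟩, hk, fun p => ?_, ?_, fun p => ?_⟩
  · dsimp only
    split_ifs with hp
    · exact .one p _
    · rw [padicValNat.eq_zero_of_not_dvd hp]
      have := hM p
      simp only [a, hp, if_false, inv_one, Matrix.mul_one] at this
      exact this.k1
  · dsimp only
    rw [Matrix.smul_mul, Matrix.one_mul, Matrix.mul_assoc, Matrix.smul_mul, ← Matrix.mul_smul,
      ← hinf, ← Matrix.mul_assoc, hinv, Matrix.one_mul]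
  · change g.fin p = 1 * δ⁻¹.map Rat.cast * (_ * a p) * _
    dsimp only
    split_ifs with hp
    · rw [Matrix.one_mul, Matrix.mul_one, Matrix.mul_assoc (δ.map _), Matrix.mul_assoc (g.fin p),
        nonsing_inv_mul _ (ha p), Matrix.mul_one, ← Matrix.mul_assoc, hinv, Matrix.one_mul]
    · simp only [a, hp, if_false, Matrix.mul_one, Matrix.one_mul]
      rw [← Matrix.mul_assoc, hinv, Matrix.one_mul]

end
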